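/- Let (Ω, μ) be a finite measure space, T > 0, c > 0, and let F : ℝ → ℝ be twice differentiable with |F''(s)| ≤ c(1 + s²) for all s ∈ ℝ. Let φ : (0,T) × Ω → ℝ and w : (0,T) × Ω → ℝ³ be measurable with respect to the product of Lebesgue measure on (0,T) and μ, and suppose ess sup_{t∈(0,T)} ‖φ(t,·)‖_{L⁶(μ)} ≤ M and ∫₀^T ‖w(t,·)‖_{L^{15/4}(μ)}^{5/3} dt ≤ K < ∞. Then ∫₀^T ∫_Ω |F''(φ(t,x))|^{5/3} |w(t,x)|^{5/3} dμ(x) dt is finite and bounded by a constant depending only on c, M, K, μ(Ω) and T. -/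

import Mathlib

open MeasureTheory ENNReal

/-- Hölder's inequality with exponents `9/5` and `9/4`, for `5/3`-th powers of a product. -/
theorem lintegral_mul_rpow_five_thirds_le {α : Type*} [MeasurableSpace α] (μ : Measure α)
    {f g : α → ℝ≥0∞} (hf : AEMeasurable f μ) (hg : AEMeasurable g μ) :
    ∫⁻ x, (f x * g x) ^ ((5 : ℝ) / 3) ∂μ ≤
      (∫⁻ x, f x ^ (3 : ℝ) ∂μ) ^ ((5 : ℝ) / 9) *
        (∫⁻ x, g x ^ ((15 : ℝ) / 4) ∂μ) ^ ((4 : ℝ) / 9) := by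
  have hpq : ((9 : ℝ) / 5).HolderConjugate (9 / 4) := by
    rw [Real.holderConjugate_iff]; norm_num
  have h := ENNReal.lintegral_mul_le_Lp_mul_Lq μ hpq (hf.pow_const ((5 : ℝ) / 3))
    (hg.pow_const ((5 : ℝ) / 3))
  simp only [Pi.mul_apply, ← ENNReal.rpow_mul] at h
  rw [show (5 : ℝ) / 3 * (9 / 5) = 3 by norm_num, show (5 : ℝ) / 3 * (9 / 4) = 15 / 4 by norm_num,
    show 1 / ((9 : ℝ) / 5) = 5 / 9 by norm_num, show 1 / ((9 : ℝ) / 4) = 4 / 9 by norm_num] at h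
  simpa only [ENNReal.mul_rpow_of_nonneg _ _ (by norm_num : (0 : ℝ) ≤ 5 / 3)] using h

theorem eLpNorm_fifteen_fourths_rpow_five_thirds {α E : Type*} [MeasurableSpace α]
    [NormedAddCommGroup E] (μ : Measure α) (f : α → E) :
    eLpNorm f (15 / 4) μ ^ ((5 : ℝ) / 3) = (∫⁻ x, ‖f x‖ₑ ^ ((15 : ℝ) / 4) ∂μ) ^ ((4 : ℝ) / 9) := by
  have h : (15 / 4 : ℝ≥0∞).toReal = 15 / 4 := by simp [ENNReal.toReal_div]
  rw [eLpNorm_eq_lintegral_rpow_enorm_toReal (by simp) (by finiteness), h, ← ENNReal.rpow_mul]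
  norm_num

theorem lintegral_growth_cube_le {α : Type*} [MeasurableSpace α] (μ : Measure α) {c M : ℝ}
    (hc : 0 ≤ c) {f : α → ℝ} (hf : eLpNorm f 6 μ ≤ ENNReal.ofReal M) :
    ∫⁻ x, ENNReal.ofReal (c * (1 + f x ^ 2)) ^ (3 : ℝ) ∂μ ≤
      ENNReal.ofReal (4 * c ^ 3) * (μ Set.univ + ENNReal.ofReal M ^ (6 : ℝ)) := by
  have hpt : ∀ x, ENNReal.ofReal (c * (1 + f x ^ 2)) ^ (3 : ℝ) ≤
      ENNReal.ofReal (4 * c ^ 3) * (1 + ‖f x‖ₑ ^ (6 : ℝ)) := fun x => by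
    have hsix : ‖f x‖ₑ ^ (6 : ℝ) = ENNReal.ofReal (f x ^ 6) := by
      rw [Real.enorm_eq_ofReal_abs, ENNReal.ofReal_rpow_of_nonneg (abs_nonneg _) (by norm_num)]
      congr 1
      exact (Real.rpow_natCast |f x| 6).trans (Even.pow_abs ⟨3, rfl⟩ _)
    have hthree : (c * (1 + f x ^ 2)) ^ (3 : ℝ) = (c * (1 + f x ^ 2)) ^ 3 :=
      Real.rpow_natCast _ 3
    rw [hsix, ENNReal.ofReal_rpow_of_nonneg (by positivity) (by norm_num), hthree,
      ← ENNReal.ofReal_one, ← ENNReal.ofReal_add (by norm_num) (by positivity),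
      ← ENNReal.ofReal_mul (by positivity)]
    apply ENNReal.ofReal_le_ofReal
    have h : (1 + f x ^ 2) ^ 3 ≤ 4 * (1 + f x ^ 6) := by
      nlinarith [mul_nonneg (by positivity : 0 ≤ 1 + f x ^ 2) (sq_nonneg (1 - f x ^ 2))]
    nlinarith [mul_le_mul_of_nonneg_left h (pow_nonneg hc 3)]
  have hsix : ∫⁻ x, ‖f x‖ₑ ^ (6 : ℝ) ∂μ = eLpNorm f 6 μ ^ (6 : ℝ) := by
    rw [eLpNorm_eq_lintegral_rpow_enorm_toReal (by simp) (by simp), ← ENNReal.rpow_mul]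
    norm_num
  calc _ ≤ ∫⁻ x, ENNReal.ofReal (4 * c ^ 3) * (1 + ‖f x‖ₑ ^ (6 : ℝ)) ∂μ := lintegral_mono hpt
    _ = ENNReal.ofReal (4 * c ^ 3) * (μ Set.univ + eLpNorm f 6 μ ^ (6 : ℝ)) := by
      rw [lintegral_const_mul' _ _ ENNReal.ofReal_ne_top, lintegral_add_left measurable_const,
        lintegral_one, hsix]
    _ ≤ _ := by gcongr

/-- If `|F''(s)| ≤ c(1+s²)`, `ess sup_t ‖φ(t,·)‖_{L⁶} ≤ M` and
`∫₀^T ‖w(t,·)‖_{L^{15/4}}^{5/3} dt ≤ K`, then `∫₀^T ∫_Ω |F''(φ)|^{5/3}|w|^{5/3}` is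
finite and bounded by a constant depending only on `c, M, K, μ(Ω), T`. -/
theorem stmt_4 {Ω : Type*} [MeasurableSpace Ω] (μ : Measure Ω) [IsFiniteMeasure μ]
    (T c M K : ℝ) (hT : 0 < T) (hc : 0 < c) (hM : 0 ≤ M) (hK : 0 ≤ K) :
    ∃ C : ℝ≥0∞, C < ⊤ ∧
      ∀ (F F' F'' : ℝ → ℝ),
        (∀ s, HasDerivAt F (F' s) s) →
        (∀ s, HasDerivAt F' (F'' s) s) →
        (∀ s, |F'' s| ≤ c * (1 + s ^ 2)) →
        ∀ (φ : ℝ × Ω → ℝ) (w : ℝ × Ω → EuclideanSpace ℝ (Fin 3)),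
          Measurable φ → Measurable w →
          (∀ᵐ t ∂(volume.restrict (Set.Ioo 0 T)),
            eLpNorm (fun x => φ (t, x)) 6 μ ≤ ENNReal.ofReal M) →
          (∫⁻ t in Set.Ioo 0 T,
              (eLpNorm (fun x => w (t, x)) (15 / 4) μ) ^ ((5 : ℝ) / 3)) ≤
            ENNReal.ofReal K →
          ∫⁻ p, (ENNReal.ofReal |F'' (φ p)| * (‖w p‖₊ : ℝ≥0∞)) ^ ((5 : ℝ) / 3)
              ∂((volume.restrict (Set.Ioo 0 T)).prod μ) ≤ C := by
  set A : ℝ≥0∞ := ENNReal.ofReal (4 * c ^ 3) * (μ Set.univ + ENNReal.ofReal M ^ (6 : ℝ))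
  have hAtop : A ^ ((5 : ℝ) / 9) ≠ ⊤ := by
    refine ENNReal.rpow_ne_top_of_nonneg (by norm_num) (ENNReal.mul_ne_top ENNReal.ofReal_ne_top ?_)
    exact ENNReal.add_ne_top.2 ⟨measure_ne_top _ _,
      ENNReal.rpow_ne_top_of_nonneg (by norm_num) ENNReal.ofReal_ne_top⟩
  refine ⟨A ^ ((5 : ℝ) / 9) * ENNReal.ofReal K,
    ENNReal.mul_lt_top hAtop.lt_top ENNReal.ofReal_lt_top, ?_⟩
  intro F F' F'' _ _ hF φ w hφ hw hM' hK'
  have hφm : Measurable fun p => ENNReal.ofReal (c * (1 + φ p ^ 2)) := by fun_prop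
  calc _ ≤ ∫⁻ p, (ENNReal.ofReal (c * (1 + φ p ^ 2)) * ‖w p‖ₑ) ^ ((5 : ℝ) / 3)
            ∂((volume.restrict (Set.Ioo 0 T)).prod μ) := by
        refine lintegral_mono fun p => ?_
        refine ENNReal.rpow_le_rpow ?_ (by norm_num)
        exact mul_le_mul' (ENNReal.ofReal_le_ofReal (hF _)) le_rfl
    _ ≤ ∫⁻ t in Set.Ioo 0 T, ∫⁻ x, (ENNReal.ofReal (c * (1 + φ (t, x) ^ 2)) * ‖w (t, x)‖ₑ) ^
          ((5 : ℝ) / 3) ∂μ := lintegral_prod_le _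
    _ ≤ ∫⁻ t in Set.Ioo 0 T, A ^ ((5 : ℝ) / 9) *
          eLpNorm (fun x => w (t, x)) (15 / 4) μ ^ ((5 : ℝ) / 3) := by
        refine lintegral_mono_ae ?_
        filter_upwards [hM'] with t ht
        rw [eLpNorm_fifteen_fourths_rpow_five_thirds]
        refine (lintegral_mul_rpow_five_thirds_le μ
          (hφm.comp measurable_prodMk_left).aemeasurable
          (hw.comp measurable_prodMk_left).enorm.aemeasurable).trans ?_
        refine mul_le_mul' (ENNReal.rpow_le_rpow ?_ (by norm_num)) le_rfl
        exact lintegral_growth_cube_le μ hc.le ht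
    _ = A ^ ((5 : ℝ) / 9) * ∫⁻ t in Set.Ioo 0 T,
          eLpNorm (fun x => w (t, x)) (15 / 4) μ ^ ((5 : ℝ) / 3) :=
        lintegral_const_mul' _ _ hAtop
    _ ≤ _ := by gcongr
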